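/- arXiv:0912.4100 — 2 statements merged into one kernel-verified Lean document; each statement's English description precedes it below -/
import Mathlib

section
/- Let θ be a real number and let G be θ-super positive. Let G' be the graph obtained from G by deleting every θ-extreme edge of G. Then every connected component of G' is a θ-base graph; that is, every θ-super positive graph can be decomposed into a disjoint union of θ-base graphs by deleting its θ-extreme edges. -/
open Polynomial

namespace MatchPoly

variable {V : Type*}

/-- The number of `r`-matchings in `G`: sets of `r` edges, no two sharing a vertex. -/
noncomputable def numMatchings (G : SimpleGraph V) (r : ℕ) : ℕ :=
  Nat.card {M : Finset (Sym2 V) // M.card = r ∧ (M : Set (Sym2 V)) ⊆ G.edgeSet ∧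
    (M : Set (Sym2 V)).Pairwise fun e f => ∀ v : V, v ∈ e → v ∉ f}

/-- The matching polynomial `μ(G,x) = ∑ (-1)^r p(G,r) x^(n-2r)`. -/
noncomputable def matchingPoly (G : SimpleGraph V) : Polynomial ℝ :=
  ∑ r ∈ Finset.range (Nat.card V + 1),
    Polynomial.C ((-1 : ℝ) ^ r * (numMatchings G r : ℝ)) *
      (Polynomial.X : Polynomial ℝ) ^ (Nat.card V - 2 * r)

/-- `mult θ G`: the multiplicity of `θ` as a root of `μ(G,x)`. -/
noncomputable def mult (θ : ℝ) (G : SimpleGraph V) : ℕ :=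
  (matchingPoly G).rootMultiplicity θ

/-- `G \ X`: the induced subgraph on the complement of the vertex set `X`. -/
def deleteSet (G : SimpleGraph V) (X : Set V) : SimpleGraph ↥(Xᶜ) :=
  G.induce (Xᶜ)

/-- `G \ v`: delete a single vertex. -/
def deleteVert (G : SimpleGraph V) (v : V) : SimpleGraph ↥({v}ᶜ : Set V) :=
  G.induce ({v}ᶜ : Set V)

/-- `u` is θ-essential: `mult(θ, G\u) = mult(θ,G) - 1`. -/
def IsEssential (θ : ℝ) (G : SimpleGraph V) (u : V) : Prop :=
  mult θ (deleteVert G u) + 1 = mult θ G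

/-- `u` is θ-neutral: `mult(θ, G\u) = mult(θ,G)`. -/
def IsNeutral (θ : ℝ) (G : SimpleGraph V) (u : V) : Prop :=
  mult θ (deleteVert G u) = mult θ G

/-- `u` is θ-positive: `mult(θ, G\u) = mult(θ,G) + 1`. -/
def IsPositive (θ : ℝ) (G : SimpleGraph V) (u : V) : Prop :=
  mult θ (deleteVert G u) = mult θ G + 1

/-- `u` is θ-special: not θ-essential but adjacent to a θ-essential vertex. -/
def IsSpecial (θ : ℝ) (G : SimpleGraph V) (u : V) : Prop :=
  ¬ IsEssential θ G u ∧ ∃ w : V, G.Adj u w ∧ IsEssential θ G w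

/-- `A_θ(G)`: the set of θ-special vertices. -/
def specialSet (θ : ℝ) (G : SimpleGraph V) : Set V := {u | IsSpecial θ G u}

/-- `N_θ(G)`: the set of θ-neutral vertices. -/
def neutralSet (θ : ℝ) (G : SimpleGraph V) : Set V := {u | IsNeutral θ G u}

/-- `P_θ(G)`: the set of θ-positive vertices that are not θ-special. -/
def positiveSet (θ : ℝ) (G : SimpleGraph V) : Set V :=
  {u | IsPositive θ G u ∧ ¬ IsSpecial θ G u}

/-- `G` is θ-super positive: `mult(θ,G) = 0` and `mult(θ,G\v) = 1` for every vertex `v`. -/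
def IsSuperPositive (θ : ℝ) (G : SimpleGraph V) : Prop :=
  mult θ G = 0 ∧ ∀ v : V, mult θ (deleteVert G v) = 1

/-- `G` is θ-elementary: θ-super positive and `P_θ(G\v) = ∅` for every vertex `v`. -/
def IsElementary (θ : ℝ) (G : SimpleGraph V) : Prop :=
  IsSuperPositive θ G ∧ ∀ v : V, positiveSet θ (deleteVert G v) = ∅

/-- `G` is θ-critical: every vertex is θ-essential and `mult(θ,G) = 1`. -/
def IsCritical (θ : ℝ) (G : SimpleGraph V) : Prop :=
  (∀ v : V, IsEssential θ G v) ∧ mult θ G = 1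

/-- `c_θ(G)`: the number of θ-critical connected components of `G`. -/
noncomputable def numCritComponents (θ : ℝ) (G : SimpleGraph V) : ℕ :=
  Nat.card {c : G.ConnectedComponent // IsCritical θ (G.induce c.supp)}

/-- `X` is a θ-barrier set: `mult(θ,G) = c_θ(G\X) - |X|`. -/
def IsBarrier (θ : ℝ) (G : SimpleGraph V) (X : Set V) : Prop :=
  numCritComponents θ (deleteSet G X) = mult θ G + X.ncard

/-- `X` is a θ-extreme set: `mult(θ,G\X) = mult(θ,G) + |X|`. -/
def IsExtreme (θ : ℝ) (G : SimpleGraph V) (X : Set V) : Prop :=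
  mult θ (deleteSet G X) = mult θ G + X.ncard

/-- `G` is θ-base: θ-super positive and no θ-barrier set contains two adjacent vertices. -/
def IsBase (θ : ℝ) (G : SimpleGraph V) : Prop :=
  IsSuperPositive θ G ∧
    ∀ X : Set V, IsBarrier θ G X → ∀ u v : V, u ∈ X → v ∈ X → ¬ G.Adj u v

/-- A finite set of non-loop edges, pairwise without common vertices. -/
def IsMatchingSet (M : Finset (Sym2 V)) : Prop :=
  (∀ e ∈ M, ¬ e.IsDiag) ∧ (M : Set (Sym2 V)).Pairwise fun e f => ∀ v : V, v ∈ e → v ∉ f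

open Classical in
/-- The finite set of matchings of the complete graph on `S`. -/
noncomputable def matchingSets (S : Finset V) : Finset (Finset (Sym2 V)) :=
  {M ∈ S.sym2.powerset | IsMatchingSet M}

/-- The matching polynomial of the complete graph on `S` with edge weights `w`. -/
noncomputable def weightedPoly (w : Sym2 V → ℝ) (S : Finset V) : ℝ[X] :=
  ∑ M ∈ matchingSets S, C (∏ e ∈ M, -w e) * X ^ (S.card - 2 * M.card)

theorem mem_matchingSets {S : Finset V} {M : Finset (Sym2 V)} :
    M ∈ matchingSets S ↔ (∀ e ∈ M, ∀ a ∈ e, a ∈ S) ∧ IsMatchingSet M := by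
  simp only [matchingSets, Finset.mem_filter, Finset.mem_powerset, Finset.subset_iff,
    Finset.mem_sym2_iff]

theorem two_mul_card_le_of_mem_matchingSets {S : Finset V} {M : Finset (Sym2 V)}
    (hM : M ∈ matchingSets S) : 2 * M.card ≤ S.card := by
  classical
  obtain ⟨hS, hd, hp⟩ := mem_matchingSets.1 hM
  have hcard : (M.biUnion Sym2.toFinset).card = ∑ e ∈ M, 2 := by
    rw [Finset.card_biUnion]
    · exact Finset.sum_congr rfl fun e he => Sym2.card_toFinset_of_not_isDiag e (hd e he)
    · intro e he f hf hef
      refine Finset.disjoint_left.2 fun a ha hb => ?_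
      exact hp he hf hef a (Sym2.mem_toFinset.1 ha) (Sym2.mem_toFinset.1 hb)
  have hsub : M.biUnion Sym2.toFinset ⊆ S := by
    intro a ha
    obtain ⟨e, he, hae⟩ := Finset.mem_biUnion.1 ha
    exact hS e he a (Sym2.mem_toFinset.1 hae)
  have := Finset.card_le_card hsub
  rw [hcard, Finset.sum_const, smul_eq_mul] at this
  omega

theorem weightedPoly_empty (w : Sym2 V → ℝ) : weightedPoly w ∅ = 1 := by
  have : matchingSets (∅ : Finset V) = {∅} := by
    ext M
    rw [mem_matchingSets, Finset.mem_singleton]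
    constructor
    · rintro ⟨h, -⟩
      rw [Finset.eq_empty_iff_forall_notMem]
      intro e he
      induction e with
      | _ a b => exact absurd (h _ he a (Sym2.mem_mk_left a b)) (Finset.notMem_empty a)
    · rintro rfl
      simp [IsMatchingSet]
  simp [weightedPoly, this]

theorem weightedPoly_congr {w w' : Sym2 V → ℝ} {S : Finset V}
    (h : ∀ a ∈ S, ∀ b ∈ S, w s(a, b) = w' s(a, b)) : weightedPoly w S = weightedPoly w' S := by
  refine Finset.sum_congr rfl fun M hM => ?_
  have hS := (mem_matchingSets.1 hM).1
  congr 2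
  refine Finset.prod_congr rfl fun e he => ?_
  induction e with
  | _ a b => rw [h a (hS _ he a (Sym2.mem_mk_left a b)) b (hS _ he b (Sym2.mem_mk_right a b))]

/-- Expansion of the weighted matching polynomial at a vertex. -/
theorem weightedPoly_eq [DecidableEq V] (w : Sym2 V → ℝ) {S : Finset V} {v : V} (hv : v ∈ S) :
    weightedPoly w S = X * weightedPoly w (S.erase v) -
      ∑ z ∈ S.erase v, C (w s(v, z)) * weightedPoly w ((S.erase v).erase z) := by
  have hunc : {M ∈ matchingSets S | ∀ e ∈ M, v ∉ e} = matchingSets (S.erase v) := by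
    ext M
    simp only [Finset.mem_filter, mem_matchingSets, Finset.mem_erase]
    constructor
    · rintro ⟨⟨h1, h2⟩, h3⟩
      exact ⟨fun e he a ha => ⟨fun h => h3 e he (h ▸ ha), h1 e he a ha⟩, h2⟩
    · rintro ⟨h1, h2⟩
      exact ⟨⟨fun e he a ha => (h1 e he a ha).2, h2⟩, fun e he ha => (h1 e he v ha).1 rfl⟩
  rw [weightedPoly, ← Finset.sum_filter_add_sum_filter_not _ (fun M => ∀ e ∈ M, v ∉ e), hunc,
    sub_eq_add_neg]
  congr 1
  · rw [weightedPoly, Finset.mul_sum]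
    refine Finset.sum_congr rfl fun M hM => ?_
    have h1 := two_mul_card_le_of_mem_matchingSets hM
    have h2 := Finset.card_erase_add_one hv
    rw [show S.card - 2 * M.card = (S.erase v).card - 2 * M.card + 1 by omega]
    ring
  · simp only [weightedPoly]
    rw [← Finset.sum_neg_distrib]
    simp only [Finset.mul_sum, ← Finset.sum_neg_distrib]
    rw [Finset.sum_sigma']
    symm
    have hnot : ∀ {z : V} {M : Finset (Sym2 V)},
        M ∈ matchingSets ((S.erase v).erase z) → ∀ z', s(v, z') ∉ M := by
      intro z M hM z' h
      have := (mem_matchingSets.1 hM).1 _ h v (Sym2.mem_mk_left v z')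
      simp at this
    refine Finset.sum_bij (fun p _ => insert s(v, p.1) p.2) ?_ ?_ ?_ ?_
    · rintro ⟨z, M⟩ hp
      obtain ⟨hz, hM⟩ := Finset.mem_sigma.1 hp
      simp only at hz hM ⊢
      obtain ⟨h1, h2, h3⟩ := mem_matchingSets.1 hM
      obtain ⟨hzv, hzS⟩ := Finset.mem_erase.1 hz
      simp only [Finset.mem_filter, mem_matchingSets]
      have hsep : ∀ f ∈ M, ∀ a, a ∈ s(v, z) → a ∉ f := by
        intro f hf a ha haf
        have := h1 f hf a haf
        rcases Sym2.mem_iff.1 ha with rfl | rfl <;> simp at this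
      refine ⟨⟨?_, ?_, ?_⟩, ?_⟩
      · intro e he a ha
        rcases Finset.mem_insert.1 he with rfl | he
        · rcases Sym2.mem_iff.1 ha with rfl | rfl <;> assumption
        · exact Finset.mem_of_mem_erase (Finset.mem_of_mem_erase (h1 e he a ha))
      · intro e he
        rcases Finset.mem_insert.1 he with rfl | he
        · simpa using hzv.symm
        · exact h2 e he
      · rw [Finset.coe_insert, Set.pairwise_insert]
        refine ⟨h3, fun f hf _ => ⟨hsep f hf, fun a ha ha' => hsep f hf a ha' ha⟩⟩
      · intro h
        exact h _ (Finset.mem_insert_self _ _) (Sym2.mem_mk_left v z)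
    · rintro ⟨z, M⟩ hp ⟨z', M'⟩ hp' heq
      obtain ⟨-, hM⟩ := Finset.mem_sigma.1 hp
      obtain ⟨-, hM'⟩ := Finset.mem_sigma.1 hp'
      simp only at hM hM' heq
      have hmem : s(v, z) ∈ insert s(v, z') M' := heq ▸ Finset.mem_insert_self _ _
      have hz : s(v, z) = s(v, z') := (Finset.mem_insert.1 hmem).resolve_right (hnot hM' z)
      obtain rfl : z = z' := Sym2.congr_right.1 hz
      have hMM : M = M' := by
        rw [← Finset.erase_insert (hnot hM z), heq, Finset.erase_insert (hnot hM' z)]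
      rw [hMM]
    · intro M hM
      simp only [Finset.mem_filter, not_forall, not_not] at hM
      obtain ⟨hM, e, he, hve⟩ := hM
      obtain ⟨h1, h2, h3⟩ := mem_matchingSets.1 hM
      obtain ⟨z, rfl⟩ := Sym2.mem_iff_exists.1 hve
      have hzS := h1 _ he z (Sym2.mem_mk_right v z)
      have hzv : z ≠ v := fun h => h2 _ he (by simp [h])
      refine ⟨⟨z, M.erase s(v, z)⟩, ?_, Finset.insert_erase he⟩
      simp only [Finset.mem_sigma, mem_matchingSets, Finset.mem_erase]
      refine ⟨⟨hzv, hzS⟩, ?_, fun f hf => h2 f (Finset.mem_of_mem_erase hf),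
        h3.mono (by simp)⟩
      rintro f ⟨hne, hf⟩ a ha
      have hsep := h3 hf he hne a ha
      simp only [Sym2.mem_iff, not_or] at hsep
      exact ⟨hsep.2, hsep.1, h1 f hf a ha⟩
    · rintro ⟨z, M⟩ hp
      obtain ⟨hz, hM⟩ := Finset.mem_sigma.1 hp
      simp only at hz hM ⊢
      have c1 := Finset.card_erase_add_one hz
      have c2 := Finset.card_erase_add_one hv
      rw [Finset.prod_insert (hnot hM z), Finset.card_insert_of_notMem (hnot hM z),
        show S.card - 2 * (M.card + 1) = ((S.erase v).erase z).card - 2 * M.card by omega]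
      simp only [C_mul, C_neg]
      ring

theorem weightedPoly_monic [DecidableEq V] (w : Sym2 V → ℝ) (S : Finset V) :
    (weightedPoly w S).Monic ∧ (weightedPoly w S).natDegree = S.card := by
  induction hn : S.card using Nat.strong_induction_on generalizing S with
  | _ n ih =>
  subst hn
  rcases S.eq_empty_or_nonempty with rfl | ⟨v, hv⟩
  · simp [weightedPoly_empty]
  have c1 := Finset.card_erase_add_one hv
  obtain ⟨hm, hd⟩ := ih _ (by omega) (S.erase v) rfl
  have hX : (X * weightedPoly w (S.erase v)).Monic := monic_X.mul hm
  have hXd : (X * weightedPoly w (S.erase v)).natDegree = S.card := by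
    rw [monic_X.natDegree_mul hm, hd, natDegree_X]
    omega
  have hlt : (∑ z ∈ S.erase v, C (w s(v, z)) * weightedPoly w ((S.erase v).erase z)).degree <
      (X * weightedPoly w (S.erase v)).degree := by
    rw [degree_eq_natDegree hX.ne_zero, hXd]
    refine lt_of_le_of_lt (degree_sum_le _ _) ?_
    refine (Finset.sup_lt_iff (WithBot.bot_lt_coe _)).2 fun z hz => ?_
    have c2 := Finset.card_erase_add_one hz
    have hzd := (ih _ (by omega) ((S.erase v).erase z) rfl).2
    refine lt_of_le_of_lt degree_le_natDegree ?_
    have := natDegree_C_mul_le (w s(v, z)) (weightedPoly w ((S.erase v).erase z))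
    exact_mod_cast (by omega : (C (w s(v, z)) * weightedPoly w ((S.erase v).erase z)).natDegree
      < S.card)
  rw [weightedPoly_eq w hv]
  refine ⟨hX.sub_of_left hlt, ?_⟩
  rw [natDegree_eq_of_degree_eq (degree_sub_eq_left_of_degree_lt hlt), hXd]

theorem weightedPoly_ne_zero (w : Sym2 V → ℝ) (S : Finset V) : weightedPoly w S ≠ 0 := by
  classical exact (weightedPoly_monic w S).1.ne_zero

theorem weightedPoly_map {U : Type*} (φ : U ↪ V) (w : Sym2 V → ℝ) (S : Finset U) :
    weightedPoly w (S.map φ) = weightedPoly (fun e => w (e.map φ)) S := by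
  classical
  induction hn : S.card using Nat.strong_induction_on generalizing S with
  | _ n ih =>
  subst hn
  rcases S.eq_empty_or_nonempty with rfl | ⟨v, hv⟩
  · simp [weightedPoly_empty]
  have c1 := Finset.card_erase_add_one hv
  rw [weightedPoly_eq w (Finset.mem_map_of_mem φ hv), weightedPoly_eq _ hv, ← Finset.map_erase,
    ih _ (by omega) _ rfl, Finset.sum_map]
  refine congrArg (HSub.hSub (α := ℝ[X]) _) (Finset.sum_congr rfl fun z hz => ?_)
  have c2 := Finset.card_erase_add_one hz
  rw [← Finset.map_erase, ih _ (by omega) _ rfl, Sym2.map_mk]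

theorem weightedPoly_union [DecidableEq V] {w : Sym2 V → ℝ} {S T : Finset V}
    (hST : Disjoint S T) (hw : ∀ a ∈ S, ∀ b ∈ T, w s(a, b) = 0) :
    weightedPoly w (S ∪ T) = weightedPoly w S * weightedPoly w T := by
  induction hn : S.card using Nat.strong_induction_on generalizing S with
  | _ n ih =>
  subst hn
  rcases S.eq_empty_or_nonempty with rfl | ⟨v, hv⟩
  · simp [weightedPoly_empty]
  have hvT : v ∉ T := Finset.disjoint_left.1 hST hv
  have key : ∀ S' ⊆ S, S'.card < S.card →
      weightedPoly w (S' ∪ T) = weightedPoly w S' * weightedPoly w T := fun S' hS' hc =>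
    ih _ hc (Finset.disjoint_of_subset_left hS' hST) (fun a ha => hw a (hS' ha)) rfl
  have c1 := Finset.card_erase_add_one hv
  rw [weightedPoly_eq w (Finset.mem_union_left T hv), weightedPoly_eq w hv,
    Finset.erase_union_distrib, Finset.erase_eq_of_notMem hvT,
    key _ (Finset.erase_subset _ _) (by omega),
    Finset.sum_union (Finset.disjoint_of_subset_left (Finset.erase_subset _ _) hST),
    Finset.sum_eq_zero (s := T) (fun z hz => by rw [hw v hv z hz, C_0, zero_mul]),
    add_zero, sub_mul, Finset.sum_mul, mul_assoc]
  refine congrArg (HSub.hSub (α := ℝ[X]) _) (Finset.sum_congr rfl fun z hz => ?_)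
  have c2 := Finset.card_erase_add_one hz
  have hzT : z ∉ T := Finset.disjoint_left.1 hST (Finset.mem_of_mem_erase hz)
  rw [Finset.erase_union_distrib, Finset.erase_eq_of_notMem hzT,
    key _ ((Finset.erase_subset _ _).trans (Finset.erase_subset _ _)) (by omega), mul_assoc]

theorem weightedPoly_update_of_notMem [DecidableEq V] (w : Sym2 V → ℝ) {S : Finset V} {u v : V}
    (h : u ∉ S ∨ v ∉ S) (t : ℝ) :
    weightedPoly (Function.update w s(u, v) t) S = weightedPoly w S := by
  refine weightedPoly_congr fun a ha b hb => Function.update_of_ne (fun hab => ?_) _ _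
  have hu : u ∈ s(a, b) := hab ▸ Sym2.mem_mk_left u v
  have hv : v ∈ s(a, b) := hab ▸ Sym2.mem_mk_right u v
  rw [Sym2.mem_iff] at hu hv
  rcases h with h | h
  · rcases hu with rfl | rfl <;> contradiction
  · rcases hv with rfl | rfl <;> contradiction

theorem weightedPoly_update [DecidableEq V] (w : Sym2 V → ℝ) {S : Finset V} {u v : V}
    (hu : u ∈ S) (hv : v ∈ S) (huv : u ≠ v) (t : ℝ) :
    weightedPoly (Function.update w s(u, v) t) S =
      weightedPoly w S - C (t - w s(u, v)) * weightedPoly w ((S.erase u).erase v) := by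
  have hvu : v ∈ S.erase u := Finset.mem_erase.2 ⟨huv.symm, hv⟩
  rw [weightedPoly_eq _ hu, weightedPoly_eq w hu,
    weightedPoly_update_of_notMem w (Or.inl (Finset.notMem_erase u S)),
    ← Finset.add_sum_erase _ _ hvu, ← Finset.add_sum_erase _ _ hvu, Function.update_self,
    weightedPoly_update_of_notMem w (Or.inr (Finset.notMem_erase v _)),
    Finset.sum_congr rfl fun z hz => by
      rw [Function.update_of_ne (show s(u, z) ≠ s(u, v) from
          fun h => Finset.ne_of_mem_erase hz (Sym2.congr_right.1 h)),
        weightedPoly_update_of_notMem w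
          (Or.inl fun h => Finset.notMem_erase u S (Finset.mem_of_mem_erase h))], C_sub]
  ring

theorem eval_mul_sub_eval_mul_nonneg [DecidableEq V] {w : Sym2 V → ℝ} (hw : ∀ e, 0 ≤ w e)
    (a : ℝ) {S : Finset V} {x y : V} (hx : x ∈ S) (hy : y ∈ S) (hxy : x ≠ y) :
    0 ≤ (weightedPoly w (S.erase x)).eval a * (weightedPoly w (S.erase y)).eval a -
      (weightedPoly w S).eval a * (weightedPoly w ((S.erase x).erase y)).eval a := by
  induction hn : S.card using Nat.strong_induction_on generalizing S x with
  | _ n ih =>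
  subst hn
  have hyx : y ∈ S.erase x := Finset.mem_erase.2 ⟨hxy.symm, hy⟩
  have hxy' : x ∈ S.erase y := Finset.mem_erase.2 ⟨hxy, hx⟩
  have e1 : (weightedPoly w S).eval a = a * (weightedPoly w (S.erase x)).eval a -
      (w s(x, y) * (weightedPoly w ((S.erase x).erase y)).eval a +
        ∑ z ∈ (S.erase x).erase y, w s(x, z) *
          (weightedPoly w ((S.erase x).erase z)).eval a) := by
    rw [weightedPoly_eq w hx, ← Finset.add_sum_erase _ _ hyx]
    simp [eval_finsetSum]
  have e2 : (weightedPoly w (S.erase y)).eval a =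
      a * (weightedPoly w ((S.erase x).erase y)).eval a -
        ∑ z ∈ (S.erase x).erase y, w s(x, z) *
          (weightedPoly w (((S.erase x).erase z).erase y)).eval a := by
    rw [weightedPoly_eq w hxy', Finset.erase_right_comm (a := y)]
    simp only [eval_sub, eval_mul, eval_X, eval_finsetSum, eval_C]
    congr 1
    exact Finset.sum_congr rfl fun z hz => by rw [Finset.erase_right_comm (a := y)]
  have e3 : (weightedPoly w (S.erase x)).eval a * (weightedPoly w (S.erase y)).eval a -
      (weightedPoly w S).eval a * (weightedPoly w ((S.erase x).erase y)).eval a =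
      w s(x, y) * (weightedPoly w ((S.erase x).erase y)).eval a ^ 2 +
        ∑ z ∈ (S.erase x).erase y, w s(x, z) *
          ((weightedPoly w ((S.erase x).erase z)).eval a *
            (weightedPoly w ((S.erase x).erase y)).eval a -
            (weightedPoly w (S.erase x)).eval a *
            (weightedPoly w (((S.erase x).erase z).erase y)).eval a) := by
    simp only [mul_sub, Finset.sum_sub_distrib]
    simp only [← mul_assoc, ← Finset.sum_mul]
    have : ∑ z ∈ (S.erase x).erase y, w s(x, z) * (weightedPoly w (S.erase x)).eval a *
            (weightedPoly w (((S.erase x).erase z).erase y)).eval a =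
        (weightedPoly w (S.erase x)).eval a * ∑ z ∈ (S.erase x).erase y, w s(x, z) *
            (weightedPoly w (((S.erase x).erase z).erase y)).eval a := by
      rw [Finset.mul_sum]
      exact Finset.sum_congr rfl fun z _ => by ring
    rw [this, e2, e1]
    ring
  rw [e3]
  have c1 := Finset.card_erase_add_one hx
  refine add_nonneg (mul_nonneg (hw _) (sq_nonneg _)) (Finset.sum_nonneg fun z hz => ?_)
  exact mul_nonneg (hw _) (ih _ (by omega) (Finset.mem_of_mem_erase hz) hyx
    (Finset.ne_of_mem_erase hz) rfl)

theorem sq_eval_le_wronskian [DecidableEq V] {w : Sym2 V → ℝ} (hw : ∀ e, 0 ≤ w e)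
    (a : ℝ) {S : Finset V} {x : V} (hx : x ∈ S) :
    (weightedPoly w (S.erase x)).eval a ^ 2 ≤
      (derivative (weightedPoly w S)).eval a * (weightedPoly w (S.erase x)).eval a -
      (weightedPoly w S).eval a * (derivative (weightedPoly w (S.erase x))).eval a := by
  induction hn : S.card using Nat.strong_induction_on generalizing S x with
  | _ n ih =>
  subst hn
  have e1 : (weightedPoly w S).eval a = a * (weightedPoly w (S.erase x)).eval a -
      ∑ z ∈ S.erase x, w s(x, z) * (weightedPoly w ((S.erase x).erase z)).eval a := by
    rw [weightedPoly_eq w hx]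
    simp [eval_finsetSum]
  have e2 : (derivative (weightedPoly w S)).eval a = (weightedPoly w (S.erase x)).eval a +
      a * (derivative (weightedPoly w (S.erase x))).eval a -
      ∑ z ∈ S.erase x, w s(x, z) *
        (derivative (weightedPoly w ((S.erase x).erase z))).eval a := by
    rw [weightedPoly_eq w hx]
    simp [eval_finsetSum]
  have e3 : (derivative (weightedPoly w S)).eval a * (weightedPoly w (S.erase x)).eval a -
      (weightedPoly w S).eval a * (derivative (weightedPoly w (S.erase x))).eval a =
      (weightedPoly w (S.erase x)).eval a ^ 2 + ∑ z ∈ S.erase x, w s(x, z) *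
        ((derivative (weightedPoly w (S.erase x))).eval a *
            (weightedPoly w ((S.erase x).erase z)).eval a -
          (weightedPoly w (S.erase x)).eval a *
            (derivative (weightedPoly w ((S.erase x).erase z))).eval a) := by
    have h1 : ∀ (c : ℝ) (f : V → ℝ), ∑ z ∈ S.erase x, w s(x, z) * (c * f z) =
        c * ∑ z ∈ S.erase x, w s(x, z) * f z := fun c f => by
      rw [Finset.mul_sum]
      exact Finset.sum_congr rfl fun z _ => by ring
    simp only [mul_sub, Finset.sum_sub_distrib, h1]
    rw [e2, e1]
    ring
  rw [e3]
  have c1 := Finset.card_erase_add_one hx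
  refine le_add_of_nonneg_right (Finset.sum_nonneg fun z hz => ?_)
  exact mul_nonneg (hw _) ((sq_nonneg _).trans (ih _ (by omega) hz rfl))

/-- If a power of `X - C θ` divides the Wronskian of `p` and `q` and the Wronskian dominates `q ^ 2`,
then roots of `p` are roots of `q` up to a loss of one in multiplicity. -/
theorem pow_dvd_of_sq_le_wronskian {p q : ℝ[X]} (θ : ℝ) (hq : q ≠ 0)
    (h : ∀ a : ℝ, q.eval a ^ 2 ≤
      (derivative p).eval a * q.eval a - p.eval a * (derivative q).eval a)
    {k : ℕ} (hp : (X - C θ) ^ (k + 1) ∣ p) : (X - C θ) ^ k ∣ q := by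
  obtain ⟨r, hr, hrθ⟩ := exists_eq_pow_rootMultiplicity_mul_and_not_dvd q hq θ
  set j := q.rootMultiplicity θ
  by_contra hk
  have hjk : j < k := by
    by_contra hle
    exact hk ((pow_dvd_pow _ (not_lt.1 hle)).trans ⟨r, hr⟩)
  obtain ⟨s, hs⟩ : (X - C θ) ^ (j + 2) ∣ p := (pow_dvd_pow _ (by omega)).trans hp
  have hpt : ∀ a : ℝ, a ≠ θ → r.eval a ^ 2 ≤ (a - θ) *
      (2 * s.eval a * r.eval a + (a - θ) * ((derivative s).eval a * r.eval a -
        s.eval a * (derivative r).eval a)) := by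
    intro a ha
    have hpos : 0 < ((a - θ) ^ j) ^ 2 := by
      have : (a - θ) ^ j ≠ 0 := pow_ne_zero _ (sub_ne_zero.2 ha)
      positivity
    have := h a
    refine le_of_mul_le_mul_left ?_ hpos
    rw [hr, hs] at this
    simp only [derivative_mul, derivative_X_sub_C_pow, eval_add, eval_mul, eval_pow, eval_sub,
      eval_X, eval_C] at this
    rcases j with _ | j
    · simp at this ⊢
      nlinarith [this]
    · simp only [Nat.cast_add, Nat.cast_ofNat, Nat.cast_one, Nat.add_sub_cancel,
        show j + 1 + 2 - 1 = j + 2 from rfl] at this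
      refine le_trans (le_of_eq ?_) (this.trans (le_of_eq ?_)) <;> ring
  have hcont : r.eval θ ^ 2 ≤ (θ - θ) *
      (2 * s.eval θ * r.eval θ + (θ - θ) * ((derivative s).eval θ * r.eval θ -
        s.eval θ * (derivative r).eval θ)) := by
    have hd : Dense ({θ}ᶜ : Set ℝ) := dense_compl_singleton θ
    have hc : IsClosed {a : ℝ | r.eval a ^ 2 ≤ (a - θ) *
      (2 * s.eval a * r.eval a + (a - θ) * ((derivative s).eval a * r.eval a -
        s.eval a * (derivative r).eval a))} :=
      isClosed_le (by fun_prop) (by fun_prop)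
    exact hc.closure_subset_iff.2 (fun a ha => hpt a ha) (hd θ)
  rw [sub_self, zero_mul] at hcont
  refine hrθ (dvd_iff_isRoot.2 ?_)
  exact pow_eq_zero_iff two_ne_zero |>.1 (le_antisymm hcont (sq_nonneg _))

theorem pow_dvd_erase [DecidableEq V] {w : Sym2 V → ℝ} (hw : ∀ e, 0 ≤ w e) (θ : ℝ)
    {S : Finset V} (x : V) {k : ℕ} (h : (X - C θ) ^ (k + 1) ∣ weightedPoly w S) :
    (X - C θ) ^ k ∣ weightedPoly w (S.erase x) := by
  by_cases hx : x ∈ S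
  · exact pow_dvd_of_sq_le_wronskian θ (weightedPoly_ne_zero w _)
      (fun a => sq_eval_le_wronskian hw a hx) h
  · rw [Finset.erase_eq_of_notMem hx]
    exact (pow_dvd_pow _ k.le_succ).trans h

theorem pow_dvd_of_pow_dvd_erase [DecidableEq V] {w : Sym2 V → ℝ} (hw : ∀ e, 0 ≤ w e) (θ : ℝ)
    {S : Finset V} (x : V) {k : ℕ} (h : (X - C θ) ^ (k + 1) ∣ weightedPoly w (S.erase x)) :
    (X - C θ) ^ k ∣ weightedPoly w S := by
  by_cases hx : x ∈ S
  · rw [weightedPoly_eq w hx]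
    refine dvd_sub (((pow_dvd_pow _ k.le_succ).trans h).mul_left _)
      (Finset.dvd_sum fun z _ => (pow_dvd_erase hw θ z h).mul_left _)
  · rw [Finset.erase_eq_of_notMem hx] at h
    exact (pow_dvd_pow _ k.le_succ).trans h

theorem pow_dvd_of_pow_dvd_sdiff [DecidableEq V] {w : Sym2 V → ℝ} (hw : ∀ e, 0 ≤ w e) (θ : ℝ)
    {S : Finset V} (Y : Finset V) {k : ℕ}
    (h : (X - C θ) ^ (k + Y.card) ∣ weightedPoly w (S \ Y)) :
    (X - C θ) ^ k ∣ weightedPoly w S := by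
  induction Y using Finset.induction_on generalizing k with
  | empty => simpa using h
  | insert y Y hy ih =>
    rw [Finset.card_insert_of_notMem hy, ← add_assoc, Finset.sdiff_insert] at h
    exact ih (pow_dvd_of_pow_dvd_erase hw θ y h)

/-- Super positivity of the complete graph on `S` with edge weights `w`. -/
def IsWeightedSuperPositive [DecidableEq V] (θ : ℝ) (w : Sym2 V → ℝ) (S : Finset V) : Prop :=
  (weightedPoly w S).eval θ ≠ 0 ∧
    ∀ x ∈ S, (weightedPoly w (S.erase x)).eval θ = 0

theorem IsWeightedSuperPositive.mul_eval_nonpos [DecidableEq V] {θ : ℝ} {w : Sym2 V → ℝ}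
    {S : Finset V} (h : IsWeightedSuperPositive θ w S) (hw : ∀ e, 0 ≤ w e) {x y : V}
    (hx : x ∈ S) (hy : y ∈ S) (hxy : x ≠ y) :
    (weightedPoly w S).eval θ * (weightedPoly w ((S.erase x).erase y)).eval θ ≤ 0 := by
  have := eval_mul_sub_eval_mul_nonneg hw θ hx hy hxy
  rw [h.2 x hx] at this
  linarith

theorem IsWeightedSuperPositive.sq_dvd [DecidableEq V] {θ : ℝ} {w : Sym2 V → ℝ}
    {S : Finset V} (h : IsWeightedSuperPositive θ w S) (hw : ∀ e, 0 ≤ w e) {x y : V}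
    (hx : x ∈ S) (hy : y ∈ S) (hxy : x ≠ y)
    (h0 : (weightedPoly w ((S.erase x).erase y)).eval θ = 0) :
    (X - C θ) ^ 2 ∣ weightedPoly w ((S.erase x).erase y) := by
  set D : ℝ[X] := weightedPoly w (S.erase x) * weightedPoly w (S.erase y) -
    weightedPoly w S * weightedPoly w ((S.erase x).erase y) with hD
  have hmin : IsLocalMin (fun a => D.eval a) θ := by
    refine Filter.Eventually.of_forall fun a => ?_
    have := eval_mul_sub_eval_mul_nonneg hw a hx hy hxy
    simp only [hD, eval_sub, eval_mul, h.2 x hx, h0]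
    linarith
  have hder := hmin.deriv_eq_zero
  rw [Polynomial.deriv] at hder
  simp only [hD, derivative_sub, derivative_mul, eval_sub, eval_add, eval_mul, h.2 x hx,
    h.2 y hy, h0, mul_zero, zero_mul, add_zero, zero_add, zero_sub, neg_eq_zero,
    mul_eq_zero, h.1, false_or] at hder
  rw [← le_rootMultiplicity_iff (weightedPoly_ne_zero w _)]
  exact (one_lt_rootMultiplicity_iff_isRoot (weightedPoly_ne_zero w _)).2 ⟨h0, hder⟩

theorem update_nonneg [DecidableEq V] {w : Sym2 V → ℝ} (hw : ∀ e, 0 ≤ w e) (e : Sym2 V) {t : ℝ}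
    (ht : 0 ≤ t) : ∀ f, 0 ≤ Function.update w e t f := by
  intro f
  rw [Function.update_apply]
  split_ifs
  exacts [ht, hw f]

/-- Changing the weight of an extreme pair preserves super positivity. -/
theorem IsWeightedSuperPositive.update [DecidableEq V] {θ : ℝ} {w : Sym2 V → ℝ}
    {S : Finset V} (h : IsWeightedSuperPositive θ w S) (hw : ∀ e, 0 ≤ w e) {u v : V}
    (hu : u ∈ S) (hv : v ∈ S) (huv : u ≠ v)
    (h0 : (weightedPoly w ((S.erase u).erase v)).eval θ = 0) (t : ℝ) :
    (weightedPoly (Function.update w s(u, v) t) S).eval θ = (weightedPoly w S).eval θ ∧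
      IsWeightedSuperPositive θ (Function.update w s(u, v) t) S := by
  have h1 : (weightedPoly (Function.update w s(u, v) t) S).eval θ =
      (weightedPoly w S).eval θ := by
    rw [weightedPoly_update w hu hv huv, eval_sub, eval_mul, h0, mul_zero, sub_zero]
  refine ⟨h1, h1 ▸ h.1, fun x hx => ?_⟩
  by_cases hxu : x = u
  · subst hxu
    rw [weightedPoly_update_of_notMem w (Or.inl (Finset.notMem_erase x S)), h.2 x hx]
  by_cases hxv : x = v
  · subst hxv
    rw [weightedPoly_update_of_notMem w (Or.inr (Finset.notMem_erase x S)), h.2 x hx]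
  have h2 : (X - C θ) ∣ weightedPoly w (((S.erase u).erase v).erase x) := by
    simpa using pow_dvd_erase hw θ x (k := 1) (h.sq_dvd hw hu hv huv h0)
  rw [weightedPoly_update w (Finset.mem_erase.2 ⟨Ne.symm hxu, hu⟩)
    (Finset.mem_erase.2 ⟨Ne.symm hxv, hv⟩) huv, Finset.erase_right_comm (a := x),
    Finset.erase_right_comm (a := x), eval_sub, eval_mul, dvd_iff_isRoot.1 h2, h.2 x hx]
  simp

/-- Two disjoint extreme pairs, one of which has positive weight, remain a root after joint
deletion. -/
theorem IsWeightedSuperPositive.eval_erase_pairs_eq_zero [DecidableEq V] {θ : ℝ}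
    {w : Sym2 V → ℝ} {S : Finset V} (h : IsWeightedSuperPositive θ w S) (hw : ∀ e, 0 ≤ w e)
    {u v x y : V} (hu : u ∈ S) (hv : v ∈ S) (huv : u ≠ v) (hx : x ∈ S) (hy : y ∈ S)
    (hxy : x ≠ y) (hxu : x ≠ u) (hxv : x ≠ v) (hyu : y ≠ u) (hyv : y ≠ v)
    (h0 : (weightedPoly w ((S.erase u).erase v)).eval θ = 0)
    (h1 : (weightedPoly w ((S.erase x).erase y)).eval θ = 0) (hpos : 0 < w s(x, y)) :
    (weightedPoly w ((((S.erase u).erase v).erase x).erase y)).eval θ = 0 := by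
  have key : ∀ t : ℝ, 0 ≤ t → (t - w s(x, y)) * ((weightedPoly w S).eval θ *
      (weightedPoly w ((((S.erase u).erase v).erase x).erase y)).eval θ) ≥ 0 := by
    intro t ht
    obtain ⟨e1, h2⟩ := h.update hw hx hy hxy h1 t
    have := h2.mul_eval_nonpos (update_nonneg hw _ ht) hu hv huv
    rw [e1, weightedPoly_update w (by simp [*]) (by simp [*]) hxy, eval_sub, eval_mul, h0,
      eval_C] at this
    linarith
  have k1 := key 0 le_rfl
  have k2 := key (2 * w s(x, y)) (by linarith)
  have k3 : (weightedPoly w S).eval θ *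
      (weightedPoly w ((((S.erase u).erase v).erase x).erase y)).eval θ = 0 := by
    nlinarith
  exact (mul_eq_zero.1 k3).resolve_left h.1

theorem IsWeightedSuperPositive.eval_update_eq_zero_iff [DecidableEq V] {θ : ℝ}
    {w : Sym2 V → ℝ} {S : Finset V} (h : IsWeightedSuperPositive θ w S) (hw : ∀ e, 0 ≤ w e)
    {u v x y : V} (hu : u ∈ S) (hv : v ∈ S) (huv : u ≠ v) (hx : x ∈ S) (hy : y ∈ S)
    (hxy : x ≠ y) (hne : s(x, y) ≠ s(u, v))
    (h0 : (weightedPoly w ((S.erase u).erase v)).eval θ = 0) (hpos : 0 < w s(x, y))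
    {t : ℝ} (ht : 0 ≤ t) :
    (weightedPoly (Function.update w s(u, v) t) ((S.erase x).erase y)).eval θ = 0 ↔
      (weightedPoly w ((S.erase x).erase y)).eval θ = 0 := by
  by_cases hmeet : u ∉ (S.erase x).erase y ∨ v ∉ (S.erase x).erase y
  · rw [weightedPoly_update_of_notMem w hmeet]
  rw [not_or, not_not, not_not] at hmeet
  obtain ⟨hu', hv'⟩ := hmeet
  have hyu : y ≠ u := (Finset.ne_of_mem_erase hu').symm
  have hyv : y ≠ v := (Finset.ne_of_mem_erase hv').symm
  have hxu : x ≠ u := (Finset.ne_of_mem_erase (Finset.mem_of_mem_erase hu')).symm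
  have hxv : x ≠ v := (Finset.ne_of_mem_erase (Finset.mem_of_mem_erase hv')).symm
  have hcomm : (((S.erase u).erase v).erase x).erase y =
      (((S.erase x).erase y).erase u).erase v := by
    ext a
    simp only [Finset.mem_erase]
    tauto
  have hexp := congrArg (eval θ) (weightedPoly_update w hu' hv' huv t)
  rw [eval_sub, eval_mul, ← hcomm] at hexp
  constructor
  · intro h2
    have h3 := (h.update hw hu hv huv h0 t).2.eval_erase_pairs_eq_zero (update_nonneg hw _ ht)
      hu hv huv hx hy hxy hxu hxv hyu hyv
      (by rwa [weightedPoly_update_of_notMem w (Or.inr (Finset.notMem_erase _ _))]) h2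
      (by rwa [Function.update_of_ne hne])
    rw [weightedPoly_update_of_notMem w (Or.inl (by simp))] at h3
    rw [h2, h3] at hexp
    linarith
  · intro h2
    have h3 := h.eval_erase_pairs_eq_zero hw hu hv huv hx hy hxy hxu hxv hyu hyv h0 h2 hpos
    rw [hexp, h2, h3]
    ring

/-- Removing a set of extreme edges preserves super positivity and the extremality of all other
edges. -/
theorem IsWeightedSuperPositive.remove_extreme [DecidableEq V] {θ : ℝ} {w : Sym2 V → ℝ}
    {S : Finset V} (h : IsWeightedSuperPositive θ w S) (hw : ∀ e, 0 ≤ w e)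
    (T : Finset (Sym2 V)) (hT : ∀ e ∈ T, ∃ u ∈ S, ∃ v ∈ S, e = s(u, v) ∧ u ≠ v ∧
      0 < w s(u, v) ∧ (weightedPoly w ((S.erase u).erase v)).eval θ = 0) :
    IsWeightedSuperPositive θ (fun e => if e ∈ T then 0 else w e) S ∧
      ∀ x ∈ S, ∀ y ∈ S, x ≠ y → s(x, y) ∉ T → 0 < w s(x, y) →
        ((weightedPoly (fun e => if e ∈ T then 0 else w e) ((S.erase x).erase y)).eval θ = 0 ↔
          (weightedPoly w ((S.erase x).erase y)).eval θ = 0) := by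
  induction T using Finset.induction_on with
  | empty => simpa using h
  | insert e T he ih =>
    obtain ⟨hsp, hiff⟩ := ih fun f hf => hT f (Finset.mem_insert_of_mem hf)
    obtain ⟨u, hu, v, hv, rfl, huv, hpos, h0⟩ := hT e (Finset.mem_insert_self e T)
    have hwT : ∀ e, 0 ≤ (fun e => if e ∈ T then 0 else w e) e := by
      intro e
      dsimp only
      split_ifs
      exacts [le_rfl, hw e]
    have hfun : (fun f => if f ∈ insert s(u, v) T then 0 else w f) =
        Function.update (fun f => if f ∈ T then 0 else w f) s(u, v) 0 := by
      ext f
      by_cases hf : f = s(u, v) <;> simp [hf]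
    have h0T := (hiff u hu v hv huv he hpos).2 h0
    rw [hfun]
    refine ⟨(hsp.update hwT hu hv huv h0T 0).2, fun x hx y hy hxy hnot hxypos => ?_⟩
    obtain ⟨hne, hxyT⟩ := not_or.1 (mt Finset.mem_insert.2 hnot)
    rw [hsp.eval_update_eq_zero_iff hwT hu hv huv hx hy hxy hne h0T (by simpa [hxyT]) le_rfl,
      hiff x hx y hy hxy hxyT hxypos]

/-- The edge weights of a graph: `1` on edges and `0` elsewhere. -/
noncomputable def edgeWeight (G : SimpleGraph V) : Sym2 V → ℝ := G.edgeSet.indicator 1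

theorem edgeWeight_nonneg (G : SimpleGraph V) (e : Sym2 V) : 0 ≤ edgeWeight G e :=
  Set.indicator_nonneg (fun _ _ => zero_le_one) e

theorem edgeWeight_pos_iff {G : SimpleGraph V} {u v : V} :
    0 < edgeWeight G s(u, v) ↔ G.Adj u v := by
  by_cases h : G.Adj u v <;> simp [edgeWeight, h]

theorem edgeWeight_eq_zero {G : SimpleGraph V} {u v : V} (h : ¬ G.Adj u v) :
    edgeWeight G s(u, v) = 0 := by
  simp [edgeWeight, h]

theorem matchingPoly_eq [Fintype V] (G : SimpleGraph V) :
    matchingPoly G = weightedPoly (edgeWeight G) Finset.univ := by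
  classical
  set s : Finset (Finset (Sym2 V)) :=
    {M ∈ matchingSets (Finset.univ : Finset V) | (M : Set (Sym2 V)) ⊆ G.edgeSet} with hs
  have hcount : ∀ r, numMatchings G r = {M ∈ s | M.card = r}.card := by
    intro r
    refine Nat.subtype_card _ fun M => ?_
    simp only [hs, Finset.mem_filter, mem_matchingSets, IsMatchingSet, Finset.mem_univ,
      implies_true, true_and]
    constructor
    · rintro ⟨⟨⟨-, h3⟩, h2⟩, h1⟩
      exact ⟨h1, h2, h3⟩
    · rintro ⟨h1, h2, h3⟩
      exact ⟨⟨⟨fun e he => G.not_isDiag_of_mem_edgeSet (h2 he), h3⟩, h2⟩, h1⟩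
  have hsum : weightedPoly (edgeWeight G) Finset.univ =
      ∑ M ∈ s, C ((-1 : ℝ) ^ M.card) * X ^ (Nat.card V - 2 * M.card) := by
    rw [weightedPoly, hs, Finset.sum_filter]
    refine Finset.sum_congr rfl fun M _ => ?_
    rw [Finset.card_univ, ← Nat.card_eq_fintype_card]
    split_ifs with hM
    · rw [Finset.prod_congr rfl fun e he => by
        rw [edgeWeight, Set.indicator_of_mem (hM he), Pi.one_apply], Finset.prod_const]
    · obtain ⟨e, he, hne⟩ := Set.not_subset.1 hM
      rw [Finset.prod_eq_zero he (by rw [edgeWeight, Set.indicator_of_notMem hne, neg_zero])]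
      simp
  rw [hsum, matchingPoly, ← Finset.sum_fiberwise_of_maps_to
    (g := Finset.card) (t := Finset.range (Nat.card V + 1))]
  · refine Finset.sum_congr rfl fun r _ => ?_
    rw [Finset.sum_congr rfl fun M hM => by rw [(Finset.mem_filter.1 hM).2], Finset.sum_const,
      hcount, nsmul_eq_mul, C_mul, C_eq_natCast]
    ring
  · intro M hM
    have := two_mul_card_le_of_mem_matchingSets (Finset.mem_filter.1 hM).1
    rw [Finset.card_univ, ← Nat.card_eq_fintype_card] at this
    exact Finset.mem_range.2 (by omega)

theorem weightedPoly_map_val {s : Set V} (G : SimpleGraph V) (S : Finset s) :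
    weightedPoly (edgeWeight (G.induce s)) S =
      weightedPoly (edgeWeight G) (S.map (Function.Embedding.subtype _)) := by
  rw [weightedPoly_map]
  refine weightedPoly_congr fun a _ b _ => ?_
  by_cases h : G.Adj a b <;> simp [edgeWeight, h]

theorem matchingPoly_induce [Fintype V] (G : SimpleGraph V) {s : Set V} {S : Finset V}
    (hS : ∀ a, a ∈ S ↔ a ∈ s) :
    matchingPoly (G.induce s) = weightedPoly (edgeWeight G) S := by
  classical
  rw [matchingPoly_eq, weightedPoly_map_val]
  congr 1
  ext a
  simp [hS]

theorem mult_eq_zero_iff [Fintype V] {θ : ℝ} {G : SimpleGraph V} {s : Set V} {S : Finset V}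
    (hS : ∀ a, a ∈ S ↔ a ∈ s) :
    mult θ (G.induce s) = 0 ↔ (weightedPoly (edgeWeight G) S).eval θ ≠ 0 := by
  rw [mult, matchingPoly_induce G hS, rootMultiplicity_eq_zero_iff]
  simp [weightedPoly_ne_zero, IsRoot]

theorem le_mult_iff [Fintype V] {θ : ℝ} {G : SimpleGraph V} {s : Set V} {S : Finset V}
    (hS : ∀ a, a ∈ S ↔ a ∈ s) {k : ℕ} :
    k ≤ mult θ (G.induce s) ↔ (X - C θ) ^ k ∣ weightedPoly (edgeWeight G) S := by
  rw [mult, matchingPoly_induce G hS, le_rootMultiplicity_iff (weightedPoly_ne_zero _ _)]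

theorem isSuperPositive_iff [Fintype V] [DecidableEq V] {θ : ℝ} {G : SimpleGraph V} :
    IsSuperPositive θ G ↔ IsWeightedSuperPositive θ (edgeWeight G) Finset.univ := by
  have h0 : mult θ G = 0 ↔ (weightedPoly (edgeWeight G) Finset.univ).eval θ ≠ 0 := by
    rw [mult, matchingPoly_eq, rootMultiplicity_eq_zero_iff]
    simp [weightedPoly_ne_zero, IsRoot]
  have hS : ∀ v a : V, a ∈ Finset.univ.erase v ↔ a ∈ ({v}ᶜ : Set V) := by simp
  rw [IsSuperPositive, IsWeightedSuperPositive, h0]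
  refine and_congr_right fun hne => forall_congr' fun v => ?_
  simp only [Finset.mem_univ, true_imp_iff]
  rw [deleteVert]
  constructor
  · intro h
    by_contra h1
    rw [← ne_eq, ← mult_eq_zero_iff (hS v), h] at h1
    exact one_ne_zero h1
  · intro h
    have hle : ¬ 2 ≤ mult θ (G.induce ({v}ᶜ : Set V)) := by
      rw [le_mult_iff (hS v)]
      intro hd
      have := pow_dvd_of_pow_dvd_erase (edgeWeight_nonneg G) θ v (k := 1) hd
      rw [pow_one, dvd_iff_isRoot] at this
      exact hne this
    have hne0 : mult θ (G.induce ({v}ᶜ : Set V)) ≠ 0 := fun h1 =>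
      (mult_eq_zero_iff (hS v)).1 h1 h
    omega

theorem IsSuperPositive.isExtreme_pair_iff [Fintype V] [DecidableEq V] {θ : ℝ}
    {G : SimpleGraph V} (h : IsSuperPositive θ G) {u v : V} (huv : u ≠ v) :
    IsExtreme θ G {u, v} ↔
      (weightedPoly (edgeWeight G) ((Finset.univ.erase u).erase v)).eval θ = 0 := by
  have hS : ∀ a : V, a ∈ (Finset.univ.erase u).erase v ↔ a ∈ ({u, v}ᶜ : Set V) := by
    intro a
    simp only [Finset.mem_erase, Finset.mem_univ, Set.mem_compl_iff, Set.mem_insert_iff,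
      Set.mem_singleton_iff]
    tauto
  have hsp := isSuperPositive_iff.1 h
  rw [IsExtreme, h.1, Set.ncard_pair huv, deleteSet]
  constructor
  · intro h2
    by_contra h1
    rw [← ne_eq, ← mult_eq_zero_iff hS, h2] at h1
    omega
  · intro h0
    have h2 := (le_mult_iff (θ := θ) (G := G) hS).2 (hsp.sq_dvd (edgeWeight_nonneg G)
      (Finset.mem_univ u) (Finset.mem_univ v) huv h0)
    have h3 : ¬ 3 ≤ mult θ (G.induce ({u, v}ᶜ : Set V)) := by
      rw [le_mult_iff hS]
      intro hd
      have := pow_dvd_of_pow_dvd_erase (edgeWeight_nonneg G) θ u (k := 1)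
        (pow_dvd_of_pow_dvd_erase (edgeWeight_nonneg G) θ v (k := 2) hd)
      rw [pow_one, dvd_iff_isRoot] at this
      exact hsp.1 this
    omega

theorem edgeWeight_eq_zero_of_mem_component {G : SimpleGraph V} {P : G.ConnectedComponent → Prop}
    {a b : V} (ha : P (G.connectedComponentMk a)) (hb : ¬ P (G.connectedComponentMk b)) :
    edgeWeight G s(a, b) = 0 :=
  edgeWeight_eq_zero fun hab =>
    hb (SimpleGraph.ConnectedComponent.connectedComponentMk_eq_of_adj hab ▸ ha)

theorem weightedPoly_filter_component [DecidableEq V] (G : SimpleGraph V) (S : Finset V)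
    (P : G.ConnectedComponent → Prop) [DecidablePred P] :
    weightedPoly (edgeWeight G) S =
      weightedPoly (edgeWeight G) {a ∈ S | P (G.connectedComponentMk a)} *
        weightedPoly (edgeWeight G) {a ∈ S | ¬ P (G.connectedComponentMk a)} := by
  rw [← weightedPoly_union (Finset.disjoint_filter_filter_not _ _ _),
    Finset.filter_union_filter_not_eq]
  intro a ha b hb
  exact edgeWeight_eq_zero_of_mem_component (P := P) (Finset.mem_filter.1 ha).2
    (Finset.mem_filter.1 hb).2

theorem pow_numCritComponents_dvd [Fintype V] (θ : ℝ) (G : SimpleGraph V) :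
    (X - C θ) ^ numCritComponents θ G ∣ matchingPoly G := by
  classical
  have key : ∀ D : Finset G.ConnectedComponent, (∀ c ∈ D, IsCritical θ (G.induce c.supp)) →
      (X - C θ) ^ D.card ∣ weightedPoly (edgeWeight G)
        {a : V | G.connectedComponentMk a ∈ D} := by
    intro D hD
    induction D using Finset.induction_on with
    | empty => simp
    | insert c D hc ih =>
      have hc1 : (X - C θ) ^ 1 ∣ weightedPoly (edgeWeight G)
          {a : V | G.connectedComponentMk a = c} :=
        (le_mult_iff (s := c.supp) (by simp)).1 (hD c (Finset.mem_insert_self c D)).2.ge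
      have hrest := ih fun d hd => hD d (Finset.mem_insert_of_mem hd)
      rw [Finset.card_insert_of_notMem hc, weightedPoly_filter_component G _ (· = c), add_comm,
        pow_add]
      refine mul_dvd_mul ?_ ?_
      · convert hc1 using 2
        ext a
        simp only [Finset.mem_filter, Finset.mem_univ, true_and, Finset.mem_insert]
        tauto
      · convert hrest using 2
        ext a
        simp only [Finset.mem_filter, Finset.mem_univ, true_and, Finset.mem_insert]
        constructor
        · tauto
        · exact fun h => ⟨Or.inr h, fun h' => hc (h' ▸ h)⟩
  let D : Finset G.ConnectedComponent :=
    (Set.toFinite {c : G.ConnectedComponent | IsCritical θ (G.induce c.supp)}).toFinset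
  have hcard : numCritComponents θ G = D.card := Nat.subtype_card D (by simp [D])
  rw [matchingPoly_eq, weightedPoly_filter_component G _ (· ∈ D), hcard]
  exact (key D (by simp [D])).mul_right _

/-- Two vertices of a barrier set form an extreme pair. -/
theorem IsBarrier.eval_erase_pair_eq_zero [Fintype V] [DecidableEq V] {θ : ℝ} {G : SimpleGraph V}
    {Y : Set V} (hY : IsBarrier θ G Y) {u v : V} (hu : u ∈ Y) (hv : v ∈ Y) (huv : u ≠ v) :
    (weightedPoly (edgeWeight G) ((Finset.univ.erase u).erase v)).eval θ = 0 := by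
  classical
  set Z : Finset V := Y.toFinset with hZ
  have huZ : u ∈ Z := by simpa [hZ] using hu
  have hvZ : v ∈ Z.erase u := by simpa [hZ, huv.symm] using hv
  have c1 := Finset.card_erase_add_one huZ
  have c2 := Finset.card_erase_add_one hvZ
  have hcard : Y.ncard = Z.card := Set.ncard_eq_toFinset_card' Y
  have hd := pow_numCritComponents_dvd θ (deleteSet G Y)
  rw [hY, deleteSet, matchingPoly_induce (S := Finset.univ \ Z) G (by simp [hZ])] at hd
  have hset : Finset.univ \ Z = ((Finset.univ.erase u).erase v) \ ((Z.erase u).erase v) := by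
    ext a
    simp only [Finset.mem_sdiff, Finset.mem_univ, Finset.mem_erase, true_and, and_true]
    constructor
    · intro ha
      exact ⟨⟨fun h => ha (h ▸ Finset.mem_of_mem_erase hvZ), fun h => ha (h ▸ huZ)⟩,
        fun h => ha h.2.2⟩
    · tauto
  rw [hset] at hd
  have := pow_dvd_of_pow_dvd_sdiff (edgeWeight_nonneg G) θ _ (k := 1)
    ((pow_dvd_pow _ (by omega)).trans hd)
  rwa [pow_one, dvd_iff_isRoot] at this

theorem map_univ_supp [Fintype V] {G : SimpleGraph V} (c : G.ConnectedComponent)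
    [Fintype c.supp] [DecidablePred fun a => G.connectedComponentMk a = c] :
    (Finset.univ : Finset c.supp).map (Function.Embedding.subtype _) =
      Finset.univ.filter fun a => G.connectedComponentMk a = c := by
  ext a
  simp

theorem IsSuperPositive.induce_component [Fintype V] {θ : ℝ} {G : SimpleGraph V}
    (h : IsSuperPositive θ G) (c : G.ConnectedComponent) :
    IsSuperPositive θ (G.induce c.supp) := by
  classical
  obtain ⟨hne, hz⟩ := isSuperPositive_iff.1 h
  rw [weightedPoly_filter_component G _ (· = c), eval_mul] at hne
  obtain ⟨hne1, hne2⟩ := mul_ne_zero_iff.1 hne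
  refine isSuperPositive_iff.2 ⟨?_, ?_⟩
  · rwa [weightedPoly_map_val, map_univ_supp]
  · rintro ⟨x, hx⟩ -
    have hx' : G.connectedComponentMk x = c := hx
    have h0 := hz x (Finset.mem_univ x)
    rw [weightedPoly_filter_component G _ (· = c), eval_mul, Finset.filter_erase,
      Finset.filter_erase, Finset.erase_eq_of_notMem
        (s := {a ∈ Finset.univ | ¬ G.connectedComponentMk a = c}) (by simp [hx'])] at h0
    rw [weightedPoly_map_val, Finset.map_erase, map_univ_supp]
    exact (mul_eq_zero.1 h0).resolve_right hne2

/-- Deleting all θ-extreme edges of a θ-super positive graph yields a disjoint union of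
θ-base graphs. -/
theorem stmt_17 {V : Type*} [Fintype V] (θ : ℝ) (G : SimpleGraph V)
    (h : IsSuperPositive θ G) (G' : SimpleGraph V)
    (hG' : G' = G.deleteEdges
      {e : Sym2 V | ∃ u v : V, e = s(u, v) ∧ G.Adj u v ∧ IsExtreme θ G {u, v}}) :
    ∀ c : G'.ConnectedComponent, IsBase θ (G'.induce c.supp) := by
  classical
  set T : Finset (Sym2 V) := (Set.toFinite {e : Sym2 V | ∃ u v : V, e = s(u, v) ∧ G.Adj u v ∧
    IsExtreme θ G {u, v}}).toFinset
  have hw : edgeWeight G' = fun e => if e ∈ T then 0 else edgeWeight G e := by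
    ext e
    rw [hG', edgeWeight, SimpleGraph.edgeSet_deleteEdges]
    by_cases he : e ∈ T
    · rw [if_pos he, Set.indicator_of_notMem]
      exact fun h' => h'.2 ((Set.Finite.mem_toFinset _).1 he)
    · rw [if_neg he, edgeWeight]
      have he' := mt (Set.Finite.mem_toFinset _).2 he
      by_cases heG : e ∈ G.edgeSet
      · rw [Set.indicator_of_mem heG, Set.indicator_of_mem (Set.mem_sdiff_of_mem heG he')]
      · rw [Set.indicator_of_notMem heG, Set.indicator_of_notMem fun h' => heG h'.1]
  obtain ⟨hsp, hiff⟩ := (isSuperPositive_iff.1 h).remove_extreme (edgeWeight_nonneg G) T (by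
    intro e he
    obtain ⟨u, v, rfl, hadj, hext⟩ := (Set.Finite.mem_toFinset _).1 he
    exact ⟨u, Finset.mem_univ u, v, Finset.mem_univ v, rfl, hadj.ne, edgeWeight_pos_iff.2 hadj,
      (h.isExtreme_pair_iff hadj.ne).1 hext⟩)
  rw [← hw] at hsp hiff
  have h' : IsSuperPositive θ G' := isSuperPositive_iff.2 hsp
  refine fun c => ⟨h'.induce_component c, ?_⟩
  rintro Y hY ⟨u, hu⟩ ⟨v, hv⟩ huY hvY hadj
  have hadj' : G'.Adj u v := hadj
  have hmem : s(u, v) ∈ G'.edgeSet := hadj'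
  rw [hG', SimpleGraph.edgeSet_deleteEdges] at hmem
  have h0 := hY.eval_erase_pair_eq_zero huY hvY hadj.ne
  rw [weightedPoly_map_val, Finset.map_erase, Finset.map_erase, map_univ_supp] at h0
  have h1 : (weightedPoly (edgeWeight G') ((Finset.univ.erase u).erase v)).eval θ = 0 := by
    rw [weightedPoly_filter_component G' _ (· = c), eval_mul, Finset.filter_erase,
      Finset.filter_erase]
    exact mul_eq_zero_of_left h0 _
  refine hmem.2 ⟨u, v, rfl, hmem.1, (h.isExtreme_pair_iff hadj'.ne).2 ?_⟩
  exact (hiff u (Finset.mem_univ u) v (Finset.mem_univ v) hadj'.ne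
    (fun hin => hmem.2 ((Set.Finite.mem_toFinset _).1 hin)) (edgeWeight_pos_iff.2 hmem.1)).1 h1

end MatchPoly
end

section
/- Let θ be a real number, let G be θ-super positive, and let u, v be distinct nonadjacent vertices of G such that {u,v} is a θ-extreme set in G. Then the graph G' obtained from G by adding the edge (u,v) is θ-super positive. -/
open Polynomial

namespace MatchPoly

variable {V : Type*}

section MatchingsWithin

open scoped Classical

variable [Fintype V]

/-- The matchings of `G` all of whose edges lie inside the vertex set `S`. -/
noncomputable def matchingsWithin (G : SimpleGraph V) (S : Finset V) :
    Finset (Finset (Sym2 V)) :=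
  {M | (∀ e ∈ M, e ∈ G.edgeSet ∧ ∀ x ∈ e, x ∈ S) ∧
    (M : Set (Sym2 V)).Pairwise fun e f => ∀ v : V, v ∈ e → v ∉ f}

/-- The matching polynomial of the subgraph of `G` induced on `S`, as a sum over matchings. -/
noncomputable def polyWithin (G : SimpleGraph V) (S : Finset V) : ℝ[X] :=
  ∑ M ∈ matchingsWithin G S, C ((-1 : ℝ) ^ M.card) * X ^ (S.card - 2 * M.card)

lemma mem_matchingsWithin {G : SimpleGraph V} {S : Finset V} {M : Finset (Sym2 V)} :
    M ∈ matchingsWithin G S ↔ (∀ e ∈ M, e ∈ G.edgeSet ∧ ∀ x ∈ e, x ∈ S) ∧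
      (M : Set (Sym2 V)).Pairwise fun e f => ∀ v : V, v ∈ e → v ∉ f := by
  simp [matchingsWithin]

lemma two_mul_card_le_of_mem_matchingsWithin {G : SimpleGraph V} {S : Finset V}
    {M : Finset (Sym2 V)} (hM : M ∈ matchingsWithin G S) : 2 * M.card ≤ S.card := by
  obtain ⟨hE, hP⟩ := mem_matchingsWithin.1 hM
  have hcard : (M.biUnion Sym2.toFinset).card = 2 * M.card := by
    rw [Finset.card_biUnion, Finset.sum_const_nat (m := 2), mul_comm]
    · intro e he
      exact Sym2.card_toFinset_of_not_isDiag e (G.not_isDiag_of_mem_edgeSet (hE e he).1)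
    · intro e he f hf hef
      rw [Function.onFun, Finset.disjoint_left]
      intro x hx hx'
      exact hP he hf hef x (Sym2.mem_toFinset.1 hx) (Sym2.mem_toFinset.1 hx')
  rw [← hcard]
  refine Finset.card_le_card fun x hx => ?_
  obtain ⟨e, he, hxe⟩ := Finset.mem_biUnion.1 hx
  exact (hE e he).2 x (Sym2.mem_toFinset.1 hxe)

lemma matchingPoly_eq_polyWithin_univ (G : SimpleGraph V) :
    matchingPoly G = polyWithin G Finset.univ := by
  have hnum (r : ℕ) : numMatchings G r =
      ((matchingsWithin G Finset.univ).filter fun M => M.card = r).card := by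
    rw [numMatchings, Nat.card_eq_fintype_card, Fintype.card_subtype]
    congr 1
    ext M
    simp only [Finset.mem_filter, Finset.mem_univ, true_and, mem_matchingsWithin, implies_true,
      and_true, Set.subset_def, Finset.mem_coe]
    tauto
  rw [polyWithin, ← Finset.sum_fiberwise_of_maps_to (t := Finset.range (Nat.card V + 1))
    (g := Finset.card)]
  · refine Finset.sum_congr rfl fun r _ => ?_
    rw [Finset.sum_congr rfl (g := fun _ => C ((-1 : ℝ) ^ r) * X ^ (Nat.card V - 2 * r))]
    · rw [Finset.sum_const, hnum, nsmul_eq_mul, C_mul, C_eq_natCast]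
      ring
    · intro M hM
      rw [(Finset.mem_filter.1 hM).2, Finset.card_univ, Nat.card_eq_fintype_card]
  · intro M hM
    have := two_mul_card_le_of_mem_matchingsWithin hM
    rw [Finset.card_univ, ← Nat.card_eq_fintype_card] at this
    rw [Finset.mem_range]
    omega

lemma polyWithin_induce_univ (G : SimpleGraph V) (s : Set V) :
    polyWithin (G.induce s) Finset.univ = polyWithin G s.toFinset := by
  have hinj : Function.Injective (Sym2.map ((↑) : s → V)) :=
    Sym2.map.injective Subtype.val_injective
  have hcard : (Finset.univ : Finset s).card = s.toFinset.card := by simp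
  refine Finset.sum_bij (fun M _ => M.image (Sym2.map (↑))) ?_ ?_ ?_ ?_
  · intro M hM
    rw [mem_matchingsWithin] at hM ⊢
    refine ⟨?_, ?_⟩
    · intro e he
      obtain ⟨e, he', rfl⟩ := Finset.mem_image.1 he
      have := (hM.1 e he').1
      induction e with | _ a b =>
      simpa using this
    · intro e he f hf hef x hxe hxf
      rw [Finset.mem_coe, Finset.mem_image] at he hf
      obtain ⟨e, he, rfl⟩ := he
      obtain ⟨f, hf, rfl⟩ := hf
      obtain ⟨a, ha, rfl⟩ := Sym2.mem_map.1 hxe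
      obtain ⟨b, hb, hab⟩ := Sym2.mem_map.1 hxf
      obtain rfl := Subtype.val_injective hab
      exact hM.2 he hf (fun h => hef (by rw [h])) _ ha hb
  · intro M _ N _ h
    exact Finset.image_injective hinj h
  · intro N hN
    rw [mem_matchingsWithin] at hN
    have himage : (N.preimage (Sym2.map (↑)) hinj.injOn).image (Sym2.map ((↑) : s → V)) = N := by
      rw [Finset.image_preimage, Finset.filter_eq_self]
      intro e he
      have := (hN.1 e he).2
      induction e with | _ a b =>
      simp only [Sym2.mem_iff, Set.mem_toFinset, forall_eq_or_imp, forall_eq] at this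
      exact ⟨s(⟨a, this.1⟩, ⟨b, this.2⟩), rfl⟩
    refine ⟨N.preimage (Sym2.map (↑)) hinj.injOn, ?_, himage⟩
    rw [mem_matchingsWithin]
    refine ⟨?_, ?_⟩
    · intro e he
      have := (hN.1 _ (Finset.mem_preimage.1 he)).1
      induction e with | _ a b =>
      simpa using this
    · intro e he f hf hef x hxe hxf
      rw [Finset.mem_coe, Finset.mem_preimage] at he hf
      exact hN.2 he hf (hinj.ne hef) x (Sym2.mem_map.2 ⟨x, hxe, rfl⟩)
        (Sym2.mem_map.2 ⟨x, hxf, rfl⟩)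
  · intro M _
    rw [Finset.card_image_of_injective _ hinj, hcard]

lemma matchingPoly_induce_s18 (G : SimpleGraph V) (s : Set V) :
    matchingPoly (G.induce s) = polyWithin G s.toFinset := by
  rw [← polyWithin_induce_univ, ← matchingPoly_eq_polyWithin_univ]

lemma polyWithin_ne_zero (G : SimpleGraph V) (S : Finset V) : polyWithin G S ≠ 0 := by
  have hcoeff : (polyWithin G S).coeff S.card = 1 := by
    rw [polyWithin, finsetSum_coeff, Finset.sum_eq_single ∅]
    · simp
    · intro M hM hne
      have := two_mul_card_le_of_mem_matchingsWithin hM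
      have := Finset.card_pos.2 (Finset.nonempty_iff_ne_empty.2 hne)
      rw [coeff_C_mul_X_pow, if_neg (by omega)]
    · exact fun h => absurd (mem_matchingsWithin.2 (by simp)) h
  intro h
  simp [h] at hcoeff

lemma polyWithin_congr {G H : SimpleGraph V} {S : Finset V}
    (h : ∀ a ∈ S, ∀ b ∈ S, G.Adj a b ↔ H.Adj a b) : polyWithin G S = polyWithin H S := by
  have : matchingsWithin G S = matchingsWithin H S := by
    ext M
    rw [mem_matchingsWithin, mem_matchingsWithin]
    refine and_congr_left fun _ => forall₂_congr fun e _ => and_congr_left fun he => ?_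
    induction e with | _ a b =>
    exact h a (he a (Sym2.mem_mk_left a b)) b (he b (Sym2.mem_mk_right a b))
  rw [polyWithin, polyWithin, this]

lemma matchingsWithin_mono {G : SimpleGraph V} {S T : Finset V} (h : S ⊆ T) :
    matchingsWithin G S ⊆ matchingsWithin G T := fun M hM => by
  rw [mem_matchingsWithin] at hM ⊢
  exact ⟨fun e he => ⟨(hM.1 e he).1, fun x hx => h ((hM.1 e he).2 x hx)⟩, hM.2⟩

lemma notMem_of_mem_matchingsWithin {G : SimpleGraph V} {S : Finset V} {M : Finset (Sym2 V)}
    (hM : M ∈ matchingsWithin G S) {e : Sym2 V} {x : V} (hx : x ∈ e) (hxS : x ∉ S) : e ∉ M :=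
  fun he => hxS (((mem_matchingsWithin.1 hM).1 e he).2 x hx)

lemma insert_mem_matchingsWithin {G : SimpleGraph V} {S : Finset V} {v w : V} (hv : v ∈ S)
    (hw : w ∈ S) (hvw : G.Adj v w) {M : Finset (Sym2 V)}
    (hM : M ∈ matchingsWithin G ((S.erase v).erase w)) :
    insert s(v, w) M ∈ matchingsWithin G S := by
  have hM' := mem_matchingsWithin.1 hM
  rw [mem_matchingsWithin]
  refine ⟨?_, ?_⟩
  · intro e he
    obtain rfl | he := Finset.mem_insert.1 he
    · exact ⟨hvw, by simp [hv, hw]⟩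
    · exact ⟨(hM'.1 e he).1, fun x hx =>
        Finset.mem_of_mem_erase (Finset.mem_of_mem_erase ((hM'.1 e he).2 x hx))⟩
  · have : Std.Symm fun e f : Sym2 V => ∀ x : V, x ∈ e → x ∉ f := ⟨fun e f h x hf he => h x he hf⟩
    rw [Finset.coe_insert, Set.pairwise_insert_of_symm]
    refine ⟨hM'.2, fun f hf _ x hx hxf => ?_⟩
    have := (hM'.1 f hf).2 x hxf
    simp only [Finset.mem_erase] at this
    obtain rfl | rfl := Sym2.mem_iff.1 hx
    · exact this.2.1 rfl
    · exact this.1 rfl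

lemma erase_mem_matchingsWithin {G : SimpleGraph V} {S : Finset V} {v w : V}
    {M : Finset (Sym2 V)} (hM : M ∈ matchingsWithin G S) (hvw : s(v, w) ∈ M) :
    M.erase s(v, w) ∈ matchingsWithin G ((S.erase v).erase w) := by
  rw [mem_matchingsWithin] at hM ⊢
  refine ⟨fun e he => ?_, hM.2.mono (Finset.coe_subset.2 (Finset.erase_subset _ _))⟩
  obtain ⟨hne, he⟩ := Finset.mem_erase.1 he
  refine ⟨(hM.1 e he).1, fun x hx => ?_⟩
  have h := hM.2 he hvw hne x hx
  rw [Sym2.mem_iff, not_or] at h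
  exact Finset.mem_erase.2 ⟨h.2, Finset.mem_erase.2 ⟨h.1, (hM.1 e he).2 x hx⟩⟩

/-- Expansion of the matching polynomial at a vertex. -/
lemma polyWithin_eq_sub_sum (G : SimpleGraph V) {S : Finset V} {v : V} (hv : v ∈ S) :
    polyWithin G S = X * polyWithin G (S.erase v) -
      ∑ w ∈ S with G.Adj v w, polyWithin G ((S.erase v).erase w) := by
  have hsplit : matchingsWithin G S = matchingsWithin G (S.erase v) ∪
      (S.filter (G.Adj v)).biUnion fun w =>
        (matchingsWithin G ((S.erase v).erase w)).image (insert s(v, w)) := by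
    ext M
    simp only [Finset.mem_union, Finset.mem_biUnion, Finset.mem_filter, Finset.mem_image]
    constructor
    · intro hM
      by_cases h : ∃ e ∈ M, v ∈ e
      · obtain ⟨e, he, w, rfl⟩ := h
        obtain ⟨hadj, hS⟩ := (mem_matchingsWithin.1 hM).1 _ he
        exact Or.inr ⟨w, ⟨hS w (Sym2.mem_mk_right v w), hadj⟩, _,
          erase_mem_matchingsWithin hM he, Finset.insert_erase he⟩
      · push Not at h
        rw [mem_matchingsWithin] at hM
        refine Or.inl (mem_matchingsWithin.2 ⟨fun e he => ⟨(hM.1 e he).1, fun x hx => ?_⟩, hM.2⟩)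
        refine Finset.mem_erase.2 ⟨?_, (hM.1 e he).2 x hx⟩
        rintro rfl
        exact h e he hx
    · rintro (hM | ⟨w, ⟨hw, hvw⟩, M, hM, rfl⟩)
      · exact matchingsWithin_mono (Finset.erase_subset v S) hM
      · exact insert_mem_matchingsWithin hv hw hvw hM
  have hnot {w : V} {M : Finset (Sym2 V)}
      (hM : M ∈ matchingsWithin G ((S.erase v).erase w)) (x : V) : s(v, x) ∉ M :=
    notMem_of_mem_matchingsWithin hM (Sym2.mem_mk_left v x) (by simp)
  rw [polyWithin, hsplit, Finset.sum_union, Finset.sum_biUnion, sub_eq_add_neg,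
    ← Finset.sum_neg_distrib]
  · congr 1
    · rw [polyWithin, Finset.mul_sum]
      refine Finset.sum_congr rfl fun M hM => ?_
      have h := two_mul_card_le_of_mem_matchingsWithin hM
      have hS := Finset.card_erase_add_one hv
      rw [show S.card - 2 * M.card = (S.erase v).card - 2 * M.card + 1 by omega]
      ring
    · refine Finset.sum_congr rfl fun w hw => ?_
      obtain ⟨hwS, hvw⟩ := Finset.mem_filter.1 hw
      have hS := Finset.card_erase_add_one hv
      have hS' := Finset.card_erase_add_one (Finset.mem_erase.2 ⟨hvw.ne', hwS⟩)
      rw [polyWithin, ← Finset.sum_neg_distrib, Finset.sum_image]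
      · refine Finset.sum_congr rfl fun M hM => ?_
        rw [Finset.card_insert_of_notMem (hnot hM w),
          show S.card - 2 * (M.card + 1) = ((S.erase v).erase w).card - 2 * M.card by omega,
          pow_succ]
        simp
      · intro M hM N hN h
        rw [← Finset.erase_insert (hnot hM w), h, Finset.erase_insert (hnot hN w)]
  · intro w _ x _ hwx
    rw [Function.onFun, Finset.disjoint_left]
    intro M hM hM'
    obtain ⟨M, hM, rfl⟩ := Finset.mem_image.1 hM
    obtain ⟨N, hN, h⟩ := Finset.mem_image.1 hM'
    have : s(v, w) ∈ insert s(v, x) N := h ▸ Finset.mem_insert_self _ _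
    obtain h | h := Finset.mem_insert.1 this
    · exact hwx (Sym2.congr_right.1 h)
    · exact hnot hN w h
  · rw [Finset.disjoint_left]
    intro M hM hM'
    obtain ⟨w, -, hM'⟩ := Finset.mem_biUnion.1 hM'
    obtain ⟨N, -, rfl⟩ := Finset.mem_image.1 hM'
    exact notMem_of_mem_matchingsWithin hM (Sym2.mem_mk_left v w) (by simp)
      (Finset.mem_insert_self _ _)

lemma polyWithin_sup_fromEdgeSet_of_notMem (G : SimpleGraph V) {S : Finset V} {u v : V}
    (h : u ∉ S ∨ v ∉ S) :
    polyWithin (G ⊔ SimpleGraph.fromEdgeSet {s(u, v)}) S = polyWithin G S := by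
  refine polyWithin_congr fun a ha b hb => ?_
  simp only [SimpleGraph.sup_adj, SimpleGraph.fromEdgeSet_adj, Set.mem_singleton_iff, Sym2.eq_iff]
  refine or_iff_left ?_
  rintro ⟨⟨rfl, rfl⟩ | ⟨rfl, rfl⟩, -⟩ <;> tauto

lemma polyWithin_sup_fromEdgeSet (G : SimpleGraph V) {S : Finset V} {u v : V} (hu : u ∈ S)
    (hv : v ∈ S) (hne : u ≠ v) (hnadj : ¬ G.Adj u v) :
    polyWithin (G ⊔ SimpleGraph.fromEdgeSet {s(u, v)}) S =
      polyWithin G S - polyWithin G ((S.erase u).erase v) := by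
  have hcongr {T : Finset V} (h : u ∉ T) :=
    polyWithin_sup_fromEdgeSet_of_notMem G (Or.inl h) (v := v)
  have hadj (w : V) : (G ⊔ SimpleGraph.fromEdgeSet {s(u, v)}).Adj u w ↔ w = v ∨ G.Adj u w := by
    simp only [SimpleGraph.sup_adj, SimpleGraph.fromEdgeSet_adj, Set.mem_singleton_iff,
      Sym2.congr_right]
    constructor
    · tauto
    · rintro (rfl | h)
      · exact Or.inr ⟨rfl, hne⟩
      · exact Or.inl h
  generalize G ⊔ SimpleGraph.fromEdgeSet {s(u, v)} = H at hcongr hadj ⊢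
  have hfilter : S.filter (H.Adj u) = insert v (S.filter (G.Adj u)) := by
    ext w
    simp only [Finset.mem_filter, Finset.mem_insert, hadj]
    constructor
    · tauto
    · rintro (rfl | h)
      · exact ⟨hv, Or.inl rfl⟩
      · exact ⟨h.1, Or.inr h.2⟩
  rw [polyWithin_eq_sub_sum H hu, polyWithin_eq_sub_sum G hu, hfilter,
    Finset.sum_insert (by simp [hnadj]), hcongr (by simp), hcongr (by simp),
    Finset.sum_congr rfl fun w _ => hcongr (by simp)]
  ring

/-- Deleting a vertex gives a nonnegative Wronskian, so `μ(G \ v) / μ(G)` is decreasing. -/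
lemma eval_wronskian_nonneg (G : SimpleGraph V) (S : Finset V) {v : V} (hv : v ∈ S) (x : ℝ) :
    0 ≤ (wronskian (polyWithin G (S.erase v)) (polyWithin G S)).eval x := by
  induction S using Finset.strongInduction generalizing v with | H S ih =>
  have key : wronskian (polyWithin G (S.erase v)) (polyWithin G S) =
      polyWithin G (S.erase v) ^ 2 + ∑ w ∈ S with G.Adj v w,
        wronskian (polyWithin G ((S.erase v).erase w)) (polyWithin G (S.erase v)) := by
    rw [polyWithin_eq_sub_sum G hv]
    simp only [wronskian, derivative_sub, derivative_mul, derivative_X, derivative_sum,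
      Finset.sum_sub_distrib, ← Finset.sum_mul]
    ring
  rw [key, eval_add, eval_pow, eval_finsetSum]
  refine add_nonneg (sq_nonneg _) (Finset.sum_nonneg fun w hw => ?_)
  obtain ⟨hwS, hvw⟩ := Finset.mem_filter.1 hw
  exact ih _ (Finset.erase_ssubset hv) (Finset.mem_erase.2 ⟨hvw.ne', hwS⟩)

end MatchingsWithin

section LocalSigns

variable {θ : ℝ}

lemma eval_nonneg_of_forall_gt {p : ℝ[X]} (h : ∀ x, θ < x → 0 ≤ p.eval x) : 0 ≤ p.eval θ :=
  ge_of_tendsto (p.continuous.continuousWithinAt (s := Set.Ioi θ))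
    (Filter.eventually_of_mem self_mem_nhdsWithin h)

lemma eval_nonpos_of_forall_lt {p : ℝ[X]} (h : ∀ x, x < θ → p.eval x ≤ 0) : p.eval θ ≤ 0 :=
  le_of_tendsto (p.continuous.continuousWithinAt (s := Set.Iio θ))
    (Filter.eventually_of_mem self_mem_nhdsWithin h)

lemma eval_nonneg_of_sq_mul {p : ℝ[X]} (h : ∀ x, 0 ≤ ((X - C θ) ^ 2 * p).eval x) :
    0 ≤ p.eval θ := by
  refine eval_nonneg_of_forall_gt fun x hx => ?_
  have := h x
  simp only [eval_mul, eval_pow, eval_sub, eval_X, eval_C] at this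
  exact nonneg_of_mul_nonneg_right this (pow_pos (sub_pos.2 hx) 2)

lemma eval_eq_zero_of_mul_nonneg {p : ℝ[X]} (h : ∀ x, 0 ≤ ((X - C θ) * p).eval x) :
    p.eval θ = 0 := by
  simp only [eval_mul, eval_sub, eval_X, eval_C] at h
  refine le_antisymm (eval_nonpos_of_forall_lt fun x hx => ?_)
    (eval_nonneg_of_forall_gt fun x hx => nonneg_of_mul_nonneg_right (h x) (sub_pos.2 hx))
  exact nonpos_of_mul_nonneg_right (h x) (sub_neg.2 hx)

lemma exists_eq_pow_mul_of_rootMultiplicity {p : ℝ[X]} {n : ℕ} (hp : p ≠ 0)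
    (h : p.rootMultiplicity θ = n) : ∃ q : ℝ[X], p = (X - C θ) ^ n * q ∧ q.eval θ ≠ 0 := by
  obtain ⟨q, hq, hdvd⟩ := exists_eq_pow_rootMultiplicity_mul_and_not_dvd p hp θ
  exact ⟨q, h ▸ hq, fun h0 => hdvd (dvd_iff_isRoot.2 h0)⟩

lemma rootMultiplicity_X_sub_C_mul {q : ℝ[X]} (hq : q.eval θ ≠ 0) :
    ((X - C θ) * q).rootMultiplicity θ = 1 := by
  have hq0 : q ≠ 0 := by
    rintro rfl
    simp at hq
  rw [rootMultiplicity_mul (mul_ne_zero (X_sub_C_ne_zero θ) hq0), rootMultiplicity_X_sub_C_self,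
    rootMultiplicity_eq_zero hq]

/-- If `f_u` has a simple root and `f` does not vanish at `θ`, a nonnegative Wronskian forces
opposite signs. -/
lemma eval_mul_eval_neg_of_simple_root {f q : ℝ[X]} (hf : f.eval θ ≠ 0) (hq : q.eval θ ≠ 0)
    (h : 0 ≤ (wronskian ((X - C θ) * q) f).eval θ) : q.eval θ * f.eval θ < 0 := by
  refine lt_of_le_of_ne ?_ (mul_ne_zero hq hf)
  simpa [wronskian] using h

lemma eval_mul_eval_neg_of_double_root {p q : ℝ[X]} (hp : p.eval θ ≠ 0) (hq : q.eval θ ≠ 0)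
    (h : ∀ x, 0 ≤ (wronskian ((X - C θ) ^ 2 * q) ((X - C θ) * p)).eval x) :
    q.eval θ * p.eval θ < 0 := by
  refine lt_of_le_of_ne ?_ (mul_ne_zero hq hp)
  have key : wronskian ((X - C θ) ^ 2 * q) ((X - C θ) * p) =
      (X - C θ) ^ 2 * ((X - C θ) * wronskian q p - q * p) := by
    simp only [wronskian, derivative_mul, derivative_pow, derivative_X_sub_C, map_natCast]
    push_cast
    ring
  rw [key] at h
  have := eval_nonneg_of_sq_mul h
  simpa using this

lemma exists_eq_mul_of_double_root {q g : ℝ[X]} (hq : q.eval θ ≠ 0)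
    (h : ∀ x, 0 ≤ (wronskian g ((X - C θ) ^ 2 * q)).eval x) :
    ∃ p : ℝ[X], g = (X - C θ) * p ∧ 0 ≤ p.eval θ * q.eval θ := by
  have key : wronskian g ((X - C θ) ^ 2 * q) =
      (X - C θ) * (2 * (g * q) + (X - C θ) * wronskian g q) := by
    simp only [wronskian, derivative_mul, derivative_pow, derivative_X_sub_C, map_natCast]
    push_cast
    ring
  have hg : g.eval θ = 0 := by
    rw [key] at h
    have := eval_eq_zero_of_mul_nonneg h
    simpa [hq] using this
  obtain ⟨p, rfl⟩ := dvd_iff_isRoot.2 hg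
  refine ⟨p, rfl, ?_⟩
  have key' : wronskian ((X - C θ) * p) ((X - C θ) ^ 2 * q) =
      (X - C θ) ^ 2 * (p * q + (X - C θ) * wronskian p q) := by
    simp only [wronskian, derivative_mul, derivative_pow, derivative_X_sub_C, map_natCast]
    push_cast
    ring
  rw [key'] at h
  have := eval_nonneg_of_sq_mul h
  simpa using this

end LocalSigns

/-- Adding an edge between the two vertices of a θ-extreme pair keeps θ-super positivity. -/
theorem stmt_18 {V : Type*} [Fintype V] (θ : ℝ) (G : SimpleGraph V)
    (h : IsSuperPositive θ G) (u v : V) (hne : u ≠ v) (hnadj : ¬ G.Adj u v)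
    (hext : IsExtreme θ G {u, v}) :
    IsSuperPositive θ (G ⊔ SimpleGraph.fromEdgeSet {s(u, v)}) := by
  classical
  have hv (H : SimpleGraph V) (w : V) :
      mult θ (deleteVert H w) = (polyWithin H (Finset.univ.erase w)).rootMultiplicity θ := by
    rw [mult, deleteVert, matchingPoly_induce_s18]
    congr 2
    ext x
    simp
  have huniv (H : SimpleGraph V) :
      mult θ H = (polyWithin H Finset.univ).rootMultiplicity θ := by
    rw [mult, matchingPoly_eq_polyWithin_univ]
  have hsub : mult θ (deleteSet G {u, v}) =
      (polyWithin G ((Finset.univ.erase u).erase v)).rootMultiplicity θ := by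
    rw [mult, deleteSet, matchingPoly_induce_s18]
    congr 2
    ext x
    simp [and_comm]
  have hvu : v ∈ Finset.univ.erase u := by simp [hne.symm]
  obtain ⟨h0, h1⟩ := h
  rw [IsExtreme, h0, hsub, Set.ncard_pair hne, zero_add] at hext
  rw [huniv] at h0
  have hf : (polyWithin G Finset.univ).eval θ ≠ 0 := fun hr =>
    ((rootMultiplicity_pos (polyWithin_ne_zero G _)).2 hr).ne' h0
  obtain ⟨e, he, he0⟩ := exists_eq_pow_mul_of_rootMultiplicity (polyWithin_ne_zero G _) hext
  refine ⟨?_, fun w => ?_⟩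
  · rw [huniv, polyWithin_sup_fromEdgeSet G (Finset.mem_univ u) (Finset.mem_univ v) hne hnadj, he]
    exact rootMultiplicity_eq_zero (by simpa [IsRoot] using hf)
  rw [hv]
  by_cases hwuv : w = u ∨ w = v
  · rw [polyWithin_sup_fromEdgeSet_of_notMem G (by rcases hwuv with rfl | rfl <;> simp), ← hv]
    exact h1 w
  rw [not_or] at hwuv
  have hsimple (x : V) : ∃ q : ℝ[X], polyWithin G (Finset.univ.erase x) = (X - C θ) * q ∧
      q.eval θ ≠ 0 ∧ q.eval θ * (polyWithin G Finset.univ).eval θ < 0 := by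
    obtain ⟨q, hq, hq0⟩ := exists_eq_pow_mul_of_rootMultiplicity (polyWithin_ne_zero G _)
      ((hv G x).symm.trans (h1 x))
    rw [pow_one] at hq
    have hW := eval_wronskian_nonneg G Finset.univ (Finset.mem_univ x) θ
    rw [hq] at hW
    exact ⟨q, hq, hq0, eval_mul_eval_neg_of_simple_root hf hq0 hW⟩
  obtain ⟨a, ha, -, haf⟩ := hsimple w
  obtain ⟨b, hb, hb0, hbf⟩ := hsimple u
  have hWu := eval_wronskian_nonneg G _ hvu
  have hWw := eval_wronskian_nonneg G ((Finset.univ.erase u).erase v) (v := w) (by simp [hwuv])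
  rw [he, hb] at hWu
  rw [he] at hWw
  have heb := eval_mul_eval_neg_of_double_root hb0 he0 hWu
  obtain ⟨c, hc, hce⟩ := exists_eq_mul_of_double_root he0 hWw
  rw [polyWithin_sup_fromEdgeSet G (by simp [Ne.symm hwuv.1]) (by simp [Ne.symm hwuv.2]) hne hnadj,
    Finset.erase_right_comm (a := w), Finset.erase_right_comm (a := w), hc, ha, ← mul_sub]
  refine rootMultiplicity_X_sub_C_mul ?_
  rw [eval_sub, sub_ne_zero]
  intro hac
  have hcf : c.eval θ * (polyWithin G Finset.univ).eval θ < 0 := hac ▸ haf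
  nlinarith [mul_pos_of_neg_of_neg heb hcf, mul_nonpos_of_nonneg_of_nonpos hce hbf.le]

end MatchPoly
end
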